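/- Let n be a positive integer and let E_n(B) = n^{-n} · Σ_{f ∈ Ω_n} B(f) be the expected value of B under the uniform distribution on Ω_n. Then E_n(B) = exp((3/2)·n^{1/3} + O(n^{1/6})); that is, there exist constants C > 0 and N such that for all n ≥ N, |log E_n(B) − (3/2)·n^{1/3}| ≤ C·n^{1/6}. -/

import Mathlib

open scoped Classical
open Function

namespace IterMap

noncomputable section

/-- A vertex `v` is cyclic for `f` if some positive iterate of `f` fixes `v`. -/
def IsCyclic {n : ℕ} (f : Fin n → Fin n) (v : Fin n) : Prop :=
  ∃ t, 0 < t ∧ f^[t] v = v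

theorem isCyclic_apply {n : ℕ} {f : Fin n → Fin n} {v : Fin n} (h : IsCyclic f v) :
    IsCyclic f (f v) := by
  obtain ⟨t, ht, hv⟩ := h
  refine ⟨t, ht, ?_⟩
  calc f^[t] (f v) = f^[t + 1] v := (Function.iterate_succ_apply f t v).symm
    _ = f (f^[t] v) := Function.iterate_succ_apply' f t v
    _ = f v := by rw [hv]

/-- The permutation induced by `f` on its cyclic vertices. -/
def cyclicPerm {n : ℕ} (f : Fin n → Fin n) :
    Equiv.Perm {v : Fin n // IsCyclic f v} :=
  Equiv.ofBijective (fun v => ⟨f v.1, isCyclic_apply v.2⟩) (by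
    rw [← Finite.injective_iff_bijective]
    intro u v huv
    have h1 : f u.1 = f v.1 := congrArg Subtype.val huv
    obtain ⟨s, hs, hsu⟩ := u.2
    obtain ⟨t, ht, htv⟩ := v.2
    have hu : f^[s * t] u.1 = u.1 := by
      rw [Function.iterate_mul]
      exact Function.iterate_fixed hsu t
    have hv : f^[s * t] v.1 = v.1 := by
      rw [mul_comm, Function.iterate_mul]
      exact Function.iterate_fixed htv s
    have hst : 0 < s * t := Nat.mul_pos hs ht
    obtain ⟨k, hk⟩ : ∃ k, s * t = k + 1 := ⟨s * t - 1, by omega⟩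
    apply Subtype.ext
    calc u.1 = f^[s * t] u.1 := hu.symm
      _ = f^[k] (f u.1) := by rw [hk, Function.iterate_succ_apply]
      _ = f^[k] (f v.1) := by rw [h1]
      _ = f^[s * t] v.1 := by rw [hk, Function.iterate_succ_apply]
      _ = v.1 := hv)

/-- `T f`: the (eventual) period of the sequence of iterates of `f`. -/
def T {n : ℕ} (f : Fin n → Fin n) : ℕ :=
  sInf {T : ℕ | 0 < T ∧ ∀ m, n ≤ m → f^[m + T] = f^[m]}

/-- `B f`: the product of the lengths of the cycles of `f`. -/
def B {n : ℕ} (f : Fin n → Fin n) : ℕ :=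
  (cyclicPerm f).cycleType.prod

/-- `Z f`: the number of cyclic vertices of `f`. -/
def Z {n : ℕ} (f : Fin n → Fin n) : ℕ :=
  Nat.card {v : Fin n // IsCyclic f v}

/-- `O f`: the number of distinct positive iterates of `f`. -/
def O {n : ℕ} (f : Fin n → Fin n) : ℕ :=
  Nat.card {g : Fin n → Fin n // ∃ t, 0 < t ∧ g = f^[t]}

/-- `f` is connected if its functional graph has one weak component. -/
def Connected {n : ℕ} (f : Fin n → Fin n) : Prop :=
  ∀ u v : Fin n, ∃ s t : ℕ, f^[s] u = f^[t] v

/-- The set of connected mappings on `[n]`. -/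
def Un (n : ℕ) : Finset (Fin n → Fin n) :=
  Finset.univ.filter fun f => Connected f

/-- `kappa n`: the average cycle length of a uniform random connected mapping. -/
def kappa (n : ℕ) : ℝ :=
  (∑ f ∈ Un n, (Z f : ℝ)) / (Un n).card

def c (d : ℕ) : ℝ :=
  ((kappa d - 1) / d) * Real.exp (-(d : ℝ)) *
    ∑ k ∈ Finset.range d, (d : ℝ) ^ k / (k.factorial : ℝ)

def F (z : ℝ) : ℝ := (1 / (1 - z)) * Real.exp (∑' d : ℕ, c d * z ^ d)

def mu (m : ℕ) : ℝ := iteratedDeriv m F 0 / (m.factorial : ℝ)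

def g (s : ℝ) : ℝ := ∑' d : ℕ, c d * Real.exp (-(d : ℝ) * s)

/-- `M m`: the average order of a uniform random permutation of `[m]`. -/
def M (m : ℕ) : ℝ :=
  (∑ σ : Equiv.Perm (Fin m), (orderOf σ : ℝ)) / (m.factorial : ℝ)

def I : ℝ :=
  ∫ t in Set.Ioi (0 : ℝ), Real.log (Real.log (Real.exp 1 / (1 - Real.exp (-t))))

def beta0 : ℝ := Real.sqrt (8 * I)

def k0 : ℝ := (3 / 2) * (3 * I) ^ ((2 : ℝ) / 3)

end

noncomputable def wt (s : Multiset ℕ) : ℕ := ∏ i ∈ s.toFinset, (s.count i).factorial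
noncomputable def bb (m : ℕ) : ℝ := ∑ p : m.Partition, (1 : ℝ) / (wt p.parts : ℝ)

theorem wt_eq (s : Multiset ℕ) (T : Finset ℕ) (h : s.toFinset ⊆ T) :
    wt s = ∏ i ∈ T, (s.count i).factorial := by
  unfold wt
  apply Finset.prod_subset h
  intro x _ hx
  have : s.count x = 0 := by simpa [Multiset.count_eq_zero] using hx
  simp [this]

theorem wt_pos (s : Multiset ℕ) : 0 < wt s := Finset.prod_pos fun _ _ => Nat.factorial_pos _

theorem wt_cons (s : Multiset ℕ) (k : ℕ) : wt (k ::ₘ s) = (s.count k + 1) * wt s := by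
  rw [wt_eq (k ::ₘ s) (insert k s.toFinset) (by simp),
    wt_eq s (insert k s.toFinset) (by simp)]
  rw [← Finset.mul_prod_erase _ _ (Finset.mem_insert_self k _),
    ← Finset.mul_prod_erase _ (fun i => (s.count i).factorial) (Finset.mem_insert_self k _)]
  rw [Multiset.count_cons_self, Nat.factorial_succ, mul_assoc]
  congr 2
  apply Finset.prod_congr rfl
  intro x hx
  rw [Multiset.count_cons_of_ne (Finset.ne_of_mem_erase hx)]

theorem perm_sum {α : Type*} [Fintype α] [DecidableEq α] :
    ∑ σ : Equiv.Perm α, (σ.cycleType.prod : ℝ) = (Fintype.card α).factorial * bb (Fintype.card α) := by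
  rw [← Finset.sum_fiberwise Finset.univ (fun σ : Equiv.Perm α => σ.partition), bb, Finset.mul_sum]
  apply Finset.sum_congr rfl
  intro p _
  set m := p.parts.filter (fun n => 2 ≤ n) with hm
  set r := p.parts.count 1 with hr
  have hp : p.parts = m + Multiset.replicate r 1 := by
    rw [← Multiset.filter_add_not (fun n => 2 ≤ n) p.parts, hr, ← Multiset.filter_eq' ]
    congr 1
    apply Multiset.filter_congr
    intro x hx
    have := p.parts_pos hx
    omega
  have hs : m.sum + r = Fintype.card α := by
    rw [← p.parts_sum, hp]; simp
  have h1 : (Finset.univ.filter fun σ : Equiv.Perm α => σ.partition = p) =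
      Finset.univ.filter fun σ : Equiv.Perm α => σ.cycleType = m := by
    ext σ
    simp only [Finset.mem_filter, Finset.mem_univ, true_and]
    constructor
    · rintro rfl
      exact Equiv.Perm.filter_parts_partition_eq_cycleType.symm
    · intro h
      rw [Nat.Partition.ext_iff, Equiv.Perm.parts_partition, h, hp, ← Equiv.Perm.sum_cycleType, h]
      congr 2; omega
  rw [h1, Finset.sum_congr rfl (g := fun _ => (m.prod : ℝ))
    (fun σ hσ => by rw [(Finset.mem_filter.1 hσ).2])]
  have h2 := Equiv.Perm.card_of_cycleType_mul_eq α m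
  have hm2 : ∀ a ∈ m, 2 ≤ a := fun a ha => (Multiset.mem_filter.1 ha).2
  rw [if_pos ⟨by omega, hm2⟩] at h2
  have h3 : Fintype.card α - m.sum = r := by omega
  have h1m : Multiset.count 1 m = 0 := by
    rw [Multiset.count_eq_zero]; intro h; have := hm2 _ h; omega
  have h4 : wt p.parts = r.factorial * wt m := by
    clear_value r m
    rw [hp]
    clear h1 h2 h3 hs hr hp
    induction r with
    | zero => simp
    | succ r ih =>
      rw [Multiset.replicate_succ, Multiset.add_cons, wt_cons, ih, Nat.factorial_succ]
      simp [h1m]; ring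
  rw [h3] at h2
  have h2' : ((Finset.univ.filter fun σ : Equiv.Perm α => σ.cycleType = m).card : ℝ) * m.prod * wt p.parts =
    (Fintype.card α).factorial := by
    rw [h4, ← h2]; push_cast; unfold wt; push_cast; ring
  have h5 : (wt p.parts : ℝ) ≠ 0 := by exact_mod_cast (wt_pos p.parts).ne'
  rw [Finset.sum_const, nsmul_eq_mul, ← h2', mul_one_div, mul_div_assoc, div_self h5, mul_one]

theorem bb_pos (m : ℕ) : 0 < bb m := by
  refine Finset.sum_pos (fun p _ => ?_) ⟨Nat.Partition.indiscrete m, Finset.mem_univ _⟩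
  have := wt_pos p.parts
  positivity

theorem bb_rec (m : ℕ) : (m : ℝ) * bb m = ∑ k ∈ Finset.Icc 1 m, (k : ℝ) * bb (m - k) := by
  have h : ∀ p : m.Partition, (m : ℝ) = ∑ k ∈ Finset.Icc 1 m, (k : ℝ) * p.parts.count k := by
    intro p
    have h1 := Finset.sum_multiset_count_of_subset p.parts (Finset.Icc 1 m) (by
      intro x hx
      have hx := Multiset.mem_toFinset.1 hx
      have h1 := p.parts_pos hx
      have h2 := p.le_of_mem_parts hx
      simp; omega)
    rw [p.parts_sum] at h1
    conv_lhs => rw [h1]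
    push_cast
    apply Finset.sum_congr rfl
    intros; simp; ring
  unfold bb
  rw [Finset.mul_sum]
  rw [Finset.sum_congr rfl (fun p _ => by
    rw [h p, Finset.sum_mul])]
  rw [Finset.sum_comm]
  apply Finset.sum_congr rfl
  intro k hk
  have hk := Finset.mem_Icc.1 hk
  rw [Finset.mul_sum]
  rw [← Finset.sum_filter_add_sum_filter_not _ (fun p : m.Partition => k ∈ p.parts)]
  rw [Finset.sum_eq_zero (f := fun p : m.Partition => (k:ℝ) * (Multiset.count k p.parts : ℝ) * (1 / (wt p.parts : ℝ))) (s := Finset.univ.filter (fun p : m.Partition => ¬ k ∈ p.parts)), add_zero]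
  · rw [Finset.sum_subtype (p := fun p : m.Partition => k ∈ p.parts) _ (by simp)]
    rw [← Equiv.sum_comp (Nat.Partition.partitionWithPartEquiv hk.1 hk.2)]
    apply Finset.sum_congr rfl
    rintro ⟨p, hp⟩ _
    rw [Nat.Partition.partitionWithPartEquiv_apply_parts]
    simp only
    obtain ⟨s, hs⟩ := Multiset.exists_cons_of_mem hp
    have := wt_pos s
    rw [hs, wt_cons, Multiset.erase_cons_head, Multiset.count_cons_self]
    push_cast
    field_simp
  · intro p hp
    have := (Finset.mem_filter.1 hp).2
    rw [Multiset.count_eq_zero.2 this]; simp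

theorem bb_zero : bb 0 = 1 := by
  unfold bb
  rw [Fintype.sum_unique]
  simp [wt]
theorem bb_rec' (m : ℕ) : ((m : ℝ) + 1) * bb (m + 1) =
    ∑ l ∈ Finset.range (m + 1), ((m : ℝ) + 1 - l) * bb l := by
  have h := bb_rec (m + 1)
  push_cast at h
  rw [h, ← Finset.sum_range_reflect, Finset.range_eq_Ico, ← Finset.Ico_succ_right_eq_Icc]
  rw [Finset.sum_Ico_eq_sum_range, ← Finset.range_eq_Ico]
  apply Finset.sum_congr (by simp)
  intro k hk
  have hk := Finset.mem_range.1 hk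
  simp at hk
  rw [show m + 1 - 1 - k = m - k by omega, show m + 1 - (1 + k) = m - k by omega,
    Nat.cast_sub (by omega)]
  push_cast; ring

theorem bb_mono : Monotone bb := by
  apply monotone_nat_of_le_succ
  intro m
  rcases m with _ | m
  · have := bb_rec' 0
    simp at this
    simp [this]
  have h1 := bb_rec' m
  have h2 := bb_rec' (m + 1)
  rw [Finset.sum_range_succ] at h2
  have h3 : ∑ l ∈ Finset.range (m + 1), ((m : ℝ) + 1 - l) * bb l ≤
      ∑ l ∈ Finset.range (m + 1), (((m + 1 : ℕ) : ℝ) + 1 - l) * bb l := by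
    apply Finset.sum_le_sum
    intro l _
    apply mul_le_mul_of_nonneg_right _ (bb_pos l).le
    push_cast; linarith
  rw [← h1] at h3
  push_cast at h2 h3
  have : ((m : ℝ) + 1 + 1) * bb (m + 1) ≤ ((m : ℝ) + 1 + 1) * bb (m + 1 + 1) := by
    rw [h2]; linarith
  exact le_of_mul_le_mul_left this (by positivity)

theorem hockey (i m : ℕ) : ∑ l ∈ Finset.range m, l.choose i = m.choose (i + 1) := by
  induction m with
  | zero => simp
  | succ m ih => rw [Finset.sum_range_succ, ih, Nat.choose_succ_succ m i, add_comm]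

theorem choose_id (i m : ℕ) : ∑ l ∈ Finset.range m, ((m : ℝ) - l) * (l.choose i : ℝ) =
    ((m + 1).choose (i + 2) : ℝ) := by
  induction m with
  | zero => simp [Nat.choose_eq_zero_of_lt (show 1 < i + 2 by omega)]
  | succ m ih =>
    have h1 : ∑ l ∈ Finset.range (m + 1), (((m + 1 : ℕ) : ℝ) - l) * (l.choose i : ℝ) =
        ∑ l ∈ Finset.range (m + 1), ((m : ℝ) - l) * (l.choose i : ℝ) +
        ∑ l ∈ Finset.range (m + 1), (l.choose i : ℝ) := by
      rw [← Finset.sum_add_distrib]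
      apply Finset.sum_congr rfl; intros; push_cast; ring
    rw [h1, Finset.sum_range_succ, ih]
    have h2 := hockey i (m + 1)
    have h2' : ∑ l ∈ Finset.range (m + 1), (l.choose i : ℝ) = ((m + 1).choose (i + 1) : ℝ) := by
      exact_mod_cast h2
    rw [h2', Nat.choose_succ_succ (m + 1) (i + 1)]
    push_cast; ring

theorem bb_lower (i m : ℕ) : (m.choose i : ℝ) / ((i + 1).factorial : ℝ) ≤ bb (m + 1) := by
  induction i generalizing m with
  | zero =>
    have := bb_mono (Nat.zero_le (m + 1))
    rw [bb_zero] at this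
    simpa using this
  | succ i ih =>
    have h := bb_rec' m
    rw [Finset.sum_range_succ'] at h
    have h1 : ∑ l ∈ Finset.range m, ((m : ℝ) - l) * ((l.choose i : ℝ) / ((i + 1).factorial : ℝ)) ≤
        ∑ k ∈ Finset.range m, ((m : ℝ) + 1 - ((k + 1 : ℕ) : ℝ)) * bb (k + 1) := by
      apply Finset.sum_le_sum
      intro l hl
      have hl : (l : ℝ) < m := by exact_mod_cast Finset.mem_range.1 hl
      push_cast
      rw [add_sub_add_right_eq_sub]
      exact mul_le_mul_of_nonneg_left (ih l) (by linarith)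
    simp_rw [← mul_div_assoc] at h1
    rw [← Finset.sum_div, choose_id] at h1
    have h0 : 0 ≤ ((m : ℝ) + 1 - ((0 : ℕ) : ℝ)) * bb 0 := by
      have := bb_pos 0
      simp; positivity
    have h2 : (((m + 1) * m.choose (i + 1) : ℕ) : ℝ) = (((m + 1).choose (i + 2) * (i + 2) : ℕ) : ℝ) := by
      exact_mod_cast Nat.add_one_mul_choose_eq m (i + 1)
    push_cast at h2
    have h3 : ((m : ℝ) + 1) * ((m.choose (i + 1) : ℝ) / ((i + 1 + 1).factorial : ℝ)) ≤
        ((m : ℝ) + 1) * bb (m + 1) := by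
      rw [← mul_div_assoc, h2, Nat.factorial_succ (i + 1)]
      push_cast
      calc _ = ((m + 1).choose (i + 2) : ℝ) / ((i + 1).factorial : ℝ) := by
            field_simp; ring
        _ ≤ _ := by linarith
    exact le_of_mul_le_mul_left h3 (by positivity)

theorem sum_kq (x : ℝ) (hx : 0 < x) (s : Finset ℕ) :
    ∑ k ∈ s, (k : ℝ) * Real.exp (-(k * x)) ≤ 1 / x ^ 2 := by
  set q := Real.exp (-x) with hq
  have hq0 : 0 < q := Real.exp_pos _
  have hq1 : q < 1 := by rw [hq]; simpa using hx
  have hqn : ‖q‖ < 1 := by rwa [Real.norm_of_nonneg hq0.le]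
  have e : ∀ k : ℕ, Real.exp (-(k * x)) = q ^ k := by
    intro k; rw [hq, ← Real.exp_nat_mul]; congr 1; ring
  simp_rw [e]
  have hs := hasSum_coe_mul_geometric_of_norm_lt_one hqn
  refine (sum_le_hasSum s (fun k _ => by positivity) hs).trans ?_
  rw [div_le_div_iff₀ (by nlinarith) (by positivity), one_mul]
  set y := Real.exp (-(x / 2)) with hy
  have hy0 : 0 < y := Real.exp_pos _
  have hqy : q = y ^ 2 := by rw [hq, hy, ← Real.exp_nat_mul]; congr 1; push_cast; ring
  have hsinh := Real.self_le_sinh_iff.2 (show 0 ≤ x / 2 by positivity)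
  rw [Real.sinh_eq, ← hy] at hsinh
  have hyy : Real.exp (x / 2) * y = 1 := by rw [hy, ← Real.exp_add]; simp
  have h1 : x * y ≤ 1 - q := by
    rw [hqy]
    nlinarith
  calc q * x ^ 2 = (x * y) ^ 2 := by rw [hqy]; ring
    _ ≤ (1 - q) ^ 2 := by
      apply pow_le_pow_left₀ (by positivity) h1

theorem bb_upper (m : ℕ) : bb m ≤ Real.exp (2 * √m) := by
  induction m using Nat.strong_induction_on with
  | _ m ih =>
    rcases Nat.eq_zero_or_pos m with rfl | hm
    · simp [bb_zero]
    have hm' : (0 : ℝ) < m := by exact_mod_cast hm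
    have hs : 0 < √(m : ℝ) := Real.sqrt_pos.2 hm'
    have hss : √(m : ℝ) * √(m : ℝ) = m := Real.mul_self_sqrt hm'.le
    have h := bb_rec m
    have h1 : ∑ k ∈ Finset.Icc 1 m, (k : ℝ) * bb (m - k) ≤
        ∑ k ∈ Finset.Icc 1 m, Real.exp (2 * √m) * ((k : ℝ) * Real.exp (-(k * (1 / √(m : ℝ))))) := by
      apply Finset.sum_le_sum
      intro k hk
      have hk := Finset.mem_Icc.1 hk
      have : bb (m - k) ≤ Real.exp (2 * √m) * Real.exp (-(k * (1 / √(m : ℝ)))) := by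
        refine (ih (m - k) (by omega)).trans ?_
        rw [← Real.exp_add]
        apply Real.exp_le_exp.2
        have h2 : √((m - k : ℕ) : ℝ) ≤ √m - k * (1 / √(m : ℝ)) / 2 := by
          have hkm : (k : ℝ) ≤ m := by exact_mod_cast hk.2
          apply Real.sqrt_le_iff.2
          constructor
          · have : k * (1 / √(m : ℝ)) ≤ √m := by
              rw [mul_one_div, div_le_iff₀ hs, hss]; exact hkm
            linarith
          · rw [Nat.cast_sub hk.2]
            have : √(m : ℝ) * (k * (1 / √(m : ℝ))) = k := by field_simp
            nlinarith [sq_nonneg (k * (1 / √(m : ℝ)))]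
        linarith
      calc (k : ℝ) * bb (m - k) ≤ k * (Real.exp (2 * √m) * Real.exp (-(k * (1 / √(m : ℝ))))) := by gcongr
        _ = _ := by ring
    rw [← Finset.mul_sum] at h1
    have h2 := sum_kq (1 / √(m : ℝ)) (by positivity) (Finset.Icc 1 m)
    have h3 : 1 / (1 / √(m : ℝ)) ^ 2 = m := by
      rw [div_pow, one_pow, one_div_one_div, sq, hss]
    rw [h3] at h2
    have h4 : m * bb m ≤ m * Real.exp (2 * √m) := by
      rw [h]
      refine h1.trans ?_
      rw [mul_comm (m : ℝ)]
      gcongr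
    exact le_of_mul_le_mul_left h4 hm'

theorem cycType_congr {n : ℕ} {p q : Fin n → Prop} (hpq : ∀ v, p v ↔ q v)
    [i1 : Fintype {v // p v}] [i2 : Fintype {v // q v}] [j1 : DecidableEq {v // p v}]
    [j2 : DecidableEq {v // q v}]
    (σ : Equiv.Perm {v // p v}) (τ : Equiv.Perm {v // q v})
    (h : ∀ v hp hq, (σ ⟨v, hp⟩).1 = (τ ⟨v, hq⟩).1) : σ.cycleType = τ.cycleType := by
  obtain rfl : p = q := funext fun v => propext (hpq v)
  obtain rfl : σ = τ := by
    ext ⟨v, hv⟩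
    rw [h v hv hv]
  obtain rfl : i1 = i2 := Subsingleton.elim _ _
  obtain rfl : j1 = j2 := Subsingleton.elim _ _
  rfl

noncomputable def cyc {n : ℕ} (f : Fin n → Fin n) : Finset (Fin n) :=
  Finset.univ.filter fun v => IsCyclic f v

theorem mem_cyc {n : ℕ} (f : Fin n → Fin n) (v : Fin n) : v ∈ cyc f ↔ IsCyclic f v := by
  simp [cyc]

noncomputable def glue {n : ℕ} (C : Finset (Fin n)) (τ : Equiv.Perm {v // v ∈ C})
    (h : {v // v ∉ C} → Fin n) : Fin n → Fin n :=
  fun v => if hv : v ∈ C then (τ ⟨v, hv⟩).1 else h ⟨v, hv⟩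

def NoInv {n : ℕ} (C : Finset (Fin n)) (h : {v // v ∉ C} → Fin n) : Prop :=
  ∀ A : Finset (Fin n), A.Nonempty → Disjoint A C → ¬ ∀ v (hv : v ∉ C), v ∈ A → h ⟨v, hv⟩ ∈ A

theorem glue_mem {n : ℕ} (C : Finset (Fin n)) (τ : Equiv.Perm {v // v ∈ C})
    (h : {v // v ∉ C} → Fin n) (v : Fin n) (hv : v ∈ C) : glue C τ h v = (τ ⟨v, hv⟩).1 := by
  simp [glue, hv]

theorem glue_not_mem {n : ℕ} (C : Finset (Fin n)) (τ : Equiv.Perm {v // v ∈ C})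
    (h : {v // v ∉ C} → Fin n) (v : Fin n) (hv : v ∉ C) : glue C τ h v = h ⟨v, hv⟩ := by
  simp [glue, hv]

theorem glue_iter {n : ℕ} (C : Finset (Fin n)) (τ : Equiv.Perm {v // v ∈ C})
    (h : {v // v ∉ C} → Fin n) (t : ℕ) (v : {v // v ∈ C}) :
    (glue C τ h)^[t] v.1 = ((τ ^ t) v).1 := by
  induction t generalizing v with
  | zero => simp
  | succ t ih =>
    rw [Function.iterate_succ_apply, glue_mem C τ h v.1 v.2, ih, pow_succ]
    rfl

theorem cyc_glue {n : ℕ} (C : Finset (Fin n)) (τ : Equiv.Perm {v // v ∈ C})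
    (h : {v // v ∉ C} → Fin n) (hh : NoInv C h) : cyc (glue C τ h) = C := by
  ext v
  rw [mem_cyc]
  constructor
  · rintro ⟨s, hs, hsv⟩
    by_contra hv
    set f := glue C τ h with hf
    have key : ∀ t, f^[t] v ∉ C := by
      intro t ht
      apply hv
      have h1 : f^[s * (t + 1)] v = v := by
        rw [Function.iterate_mul]; exact Function.iterate_fixed hsv _
      obtain ⟨d, hd⟩ : ∃ d, s * (t + 1) = d + t :=
        ⟨s * (t + 1) - t, by have := Nat.le_mul_of_pos_left (t + 1) hs; omega⟩
      rw [hd, Function.iterate_add_apply] at h1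
      rw [← h1, hf, glue_iter C τ h d ⟨_, ht⟩]
      exact Subtype.property _
    refine hh (Finset.univ.filter fun w => ∃ t, f^[t] v = w) ⟨v, ?_⟩ ?_ ?_
    · simp only [Finset.mem_filter, Finset.mem_univ, true_and]
      exact ⟨0, rfl⟩
    · rw [Finset.disjoint_left]
      intro w hw
      simp only [Finset.mem_filter, Finset.mem_univ, true_and] at hw
      obtain ⟨t, rfl⟩ := hw
      exact key t
    · intro w hw hwA
      simp only [Finset.mem_filter, Finset.mem_univ, true_and] at hwA ⊢
      obtain ⟨t, rfl⟩ := hwA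
      refine ⟨t + 1, ?_⟩
      rw [Function.iterate_succ_apply', ← glue_not_mem C τ h _ hw]
  · intro hv
    refine ⟨orderOf τ, orderOf_pos τ, ?_⟩
    rw [glue_iter C τ h _ ⟨v, hv⟩, pow_orderOf_eq_one]
    rfl

theorem B_glue {n : ℕ} (C : Finset (Fin n)) (τ : Equiv.Perm {v // v ∈ C})
    (h : {v // v ∉ C} → Fin n) (hh : NoInv C h) : B (glue C τ h) = τ.cycleType.prod := by
  unfold B
  congr 1
  apply cycType_congr
  · intro v
    rw [← mem_cyc, cyc_glue C τ h hh]
  · intro v hp hq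
    rw [← glue_mem C τ h v hq]
    rfl

theorem exists_glue {n : ℕ} (C : Finset (Fin n)) (f : Fin n → Fin n) (hf : cyc f = C) :
    ∃ τ h, NoInv C h ∧ glue C τ h = f := by
  have hC : ∀ v, IsCyclic f v ↔ v ∈ C := fun v => by rw [← mem_cyc, hf]
  refine ⟨(Equiv.subtypeEquivRight hC).permCongr (cyclicPerm f), fun v => f v.1, ?_, ?_⟩
  · intro A hA hd hc
    obtain ⟨v, hv⟩ := hA
    have key : ∀ t, f^[t] v ∈ A := by
      intro t
      induction t with
      | zero => exact hv
      | succ t ih =>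
        rw [Function.iterate_succ_apply']
        exact hc _ (Finset.disjoint_left.1 hd ih) ih
    obtain ⟨i, j, hij, he⟩ := Finite.exists_ne_map_eq_of_infinite (fun t : ℕ => f^[t] v)
    wlog hlt : i < j generalizing i j
    · exact this j i hij.symm he.symm (by omega)
    apply Finset.disjoint_left.1 hd (key i)
    rw [← hC]
    refine ⟨j - i, by omega, ?_⟩
    rw [← Function.iterate_add_apply, show j - i + i = j by omega]
    exact he.symm
  · ext v
    by_cases hv : v ∈ C
    · rw [glue_mem C _ _ v hv]; rfl
    · rw [glue_not_mem C _ _ v hv]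

noncomputable def NN {n : ℕ} (C : Finset (Fin n)) : ℕ :=
  (Finset.univ.filter fun h : {v // v ∉ C} → Fin n => NoInv C h).card

theorem fibre_sum {n : ℕ} (C : Finset (Fin n)) (Ψ : (Fin n → Fin n) → ℝ)
    (Φ : Equiv.Perm {v // v ∈ C} → ℝ) (hΨ : ∀ τ h, NoInv C h → Ψ (glue C τ h) = Φ τ) :
    ∑ f ∈ Finset.univ.filter (fun f : Fin n → Fin n => cyc f = C), Ψ f = NN C * ∑ τ, Φ τ := by
  have h1 : (NN C : ℝ) * ∑ τ, Φ τ = ∑ x ∈ (Finset.univ : Finset (Equiv.Perm {v // v ∈ C})) ×ˢ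
      (Finset.univ.filter fun h : {v // v ∉ C} → Fin n => NoInv C h), Φ x.1 := by
    rw [Finset.sum_product, Finset.mul_sum]
    apply Finset.sum_congr rfl
    intro τ _
    simp only [Finset.sum_const, nsmul_eq_mul, NN]
  rw [h1]
  symm
  apply Finset.sum_bij (fun x _ => glue C x.1 x.2)
  · intro x hx
    simp only [Finset.mem_product, Finset.mem_filter, Finset.mem_univ, true_and] at hx ⊢
    exact cyc_glue C _ _ hx
  · rintro ⟨τ, h⟩ _ ⟨τ', h'⟩ _ he
    simp only at he
    ext v
    · have := congrFun he v.1
      rw [glue_mem C τ h v.1 v.2, glue_mem C τ' h' v.1 v.2] at this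
      rw [this]
    · have := congrFun he v.1
      rw [glue_not_mem C τ h v.1 v.2, glue_not_mem C τ' h' v.1 v.2] at this
      simpa using congrArg Fin.val this
  · intro f hf
    simp only [Finset.mem_filter, Finset.mem_univ, true_and] at hf
    obtain ⟨τ, h, hh, rfl⟩ := exists_glue C f hf
    exact ⟨(τ, h), by simp [hh], rfl⟩
  · intro x hx
    simp only [Finset.mem_product, Finset.mem_filter, Finset.mem_univ, true_and] at hx
    exact (hΨ _ _ hx).symm

theorem sum_B (n : ℕ) : ∑ f : Fin n → Fin n, (B f : ℝ) =
    ∑ C : Finset (Fin n), (NN C : ℝ) * (C.card.factorial * bb C.card) := by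
  rw [← Finset.sum_fiberwise Finset.univ (fun f : Fin n → Fin n => cyc f)]
  apply Finset.sum_congr rfl
  intro C _
  rw [fibre_sum C (fun f => (B f : ℝ)) (fun τ => (τ.cycleType.prod : ℝ))
    (fun τ h hh => by simp only [B_glue C τ h hh]), perm_sum]
  simp

theorem NN_le {n : ℕ} (C : Finset (Fin n)) : NN C ≤ n ^ (n - C.card) := by
  refine (Finset.card_filter_le _ _).trans ?_
  rw [Finset.card_univ, Fintype.card_fun, Fintype.card_fin]
  apply le_of_eq
  congr 1
  rw [Fintype.card_subtype_compl]
  simp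

theorem sum_B_le (n : ℕ) : ∑ f : Fin n → Fin n, (B f : ℝ) ≤
    ∑ m ∈ Finset.range (n + 1), (n.choose m : ℝ) * ((n : ℝ) ^ (n - m) * (m.factorial * bb m)) := by
  rw [sum_B]
  have h := Finset.sum_powerset_apply_card
    (fun m => (n : ℝ) ^ (n - m) * (m.factorial * bb m)) (x := (Finset.univ : Finset (Fin n)))
  rw [Finset.card_univ, Fintype.card_fin, Finset.powerset_univ] at h
  simp only [nsmul_eq_mul] at h
  rw [← h]
  apply Finset.sum_le_sum
  intro C _
  have := bb_pos C.card
  have h2 : (NN C : ℝ) ≤ (n : ℝ) ^ (n - C.card) := by exact_mod_cast NN_le C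
  gcongr

theorem card_fix {n : ℕ} (C S : Finset (Fin n)) (hSC : S ⊆ C) :
    (Finset.univ.filter fun τ : Equiv.Perm {v // v ∈ C} => ∀ v, v.1 ∈ S → τ v = v).card =
      (C.card - S.card).factorial := by
  have e := (Equiv.Perm.subtypeEquivSubtypePerm (fun v : {v // v ∈ C} => v.1 ∉ S))
  have h := Fintype.card_congr e
  rw [Fintype.card_perm, Fintype.card_subtype_compl, Fintype.card_coe,
    Fintype.card_subtype (fun v : {v // v ∈ C} => v.1 ∈ S)] at h
  simp only [not_not] at h
  rw [← Fintype.card_subtype, ← h]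
  congr 2
  rw [← Finset.card_map (Function.Embedding.subtype _)]
  congr 1
  ext v
  simp
  exact fun h => hSC h

theorem fix_count {n : ℕ} (S : Finset (Fin n)) :
    ((n ^ (n - S.card) : ℕ) : ℝ) =
      ∑ C : Finset (Fin n), if S ⊆ C then (NN C : ℝ) * (C.card - S.card).factorial else 0 := by
  have h1 : (Finset.univ.filter fun f : Fin n → Fin n => ∀ v ∈ S, f v = v).card = n ^ (n - S.card) := by
    have : (Finset.univ.filter fun f : Fin n → Fin n => ∀ v ∈ S, f v = v) =
        Fintype.piFinset (fun v : Fin n => if v ∈ S then {v} else Finset.univ) := by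
      ext f
      simp only [Finset.mem_filter, Finset.mem_univ, true_and, Fintype.mem_piFinset]
      apply forall_congr'
      intro v
      by_cases hv : v ∈ S <;> simp [hv]
    rw [this, Fintype.card_piFinset]
    have h2 : ∀ v : Fin n, (if v ∈ S then ({v} : Finset (Fin n)) else Finset.univ).card =
        if v ∈ S then 1 else n := by
      intro v; by_cases hv : v ∈ S <;> simp [hv]
    simp_rw [h2]
    rw [Finset.prod_ite, Finset.prod_const_one, one_mul, Finset.prod_const]
    congr 1
    rw [Finset.filter_not, Finset.card_sdiff_of_subset (Finset.filter_subset _ _)]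
    simp
  rw [← h1, Finset.card_filter]
  push_cast
  rw [← Finset.sum_fiberwise Finset.univ (fun f : Fin n → Fin n => cyc f)]
  apply Finset.sum_congr rfl
  intro C _
  split_ifs with hSC
  · rw [fibre_sum C _ (fun τ => if ∀ v : {v // v ∈ C}, v.1 ∈ S → τ v = v then (1 : ℝ) else 0)]
    · rw [Finset.sum_boole, card_fix C S hSC]
    · intro τ h hh
      congr 1
      apply propext
      constructor
      · intro H v hv
        apply Subtype.ext
        rw [← glue_mem C τ h v.1 v.2]
        exact H v hv
      · intro H v hv
        rw [glue_mem C τ h v (hSC hv), H ⟨v, hSC hv⟩ hv]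
  · apply Finset.sum_eq_zero
    intro f hf
    simp only [Finset.mem_filter, Finset.mem_univ, true_and] at hf
    rw [if_neg]
    intro H
    apply hSC
    intro v hv
    rw [← hf, mem_cyc]
    exact ⟨1, one_pos, H v hv⟩

theorem le_sum_B (n m : ℕ) :
    (n.choose m : ℝ) * ((n : ℝ) ^ (n - m) * (m.factorial * bb m)) ≤ ∑ f : Fin n → Fin n, (B f : ℝ) := by
  rw [sum_B]
  have h1 : (n.choose m : ℝ) * ((n : ℝ) ^ (n - m) * (m.factorial * bb m)) =
      ∑ S ∈ Finset.powersetCard m (Finset.univ : Finset (Fin n)),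
        (∑ C : Finset (Fin n), if S ⊆ C then (NN C : ℝ) * (C.card - m).factorial else 0) *
          (m.factorial * bb m) := by
    rw [Finset.sum_congr rfl (g := fun _ => (n : ℝ) ^ (n - m) * (m.factorial * bb m))]
    · rw [Finset.sum_const, Finset.card_powersetCard, nsmul_eq_mul]; simp
    · intro S hS
      have hS := (Finset.mem_powersetCard.1 hS).2
      have := fix_count S
      rw [hS] at this
      rw [← this]
      push_cast; rfl
  rw [h1, ← Finset.sum_mul, Finset.sum_comm, Finset.sum_mul]
  apply Finset.sum_le_sum
  intro C _
  have hb := bb_pos m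
  have h2 : (∑ S ∈ Finset.powersetCard m (Finset.univ : Finset (Fin n)),
      if S ⊆ C then (NN C : ℝ) * (C.card - m).factorial else 0) =
      (C.card.choose m : ℝ) * ((NN C : ℝ) * (C.card - m).factorial) := by
    rw [← Finset.sum_filter, Finset.sum_const, nsmul_eq_mul]
    congr 2
    rw [← Finset.card_powersetCard]
    congr 1
    ext S
    simp [Finset.mem_powersetCard, and_comm]
  rw [h2]
  by_cases hm : m ≤ C.card
  · have h3 : (C.card.choose m : ℝ) * m.factorial * (C.card - m).factorial = C.card.factorial := by
      exact_mod_cast Nat.choose_mul_factorial_mul_factorial hm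
    calc _ = (NN C : ℝ) * ((C.card.choose m : ℝ) * m.factorial * (C.card - m).factorial * bb m) := by ring
      _ ≤ _ := by
        rw [h3]
        gcongr
        exact bb_mono hm
  · rw [Nat.choose_eq_zero_of_lt (by omega)]
    have := bb_pos C.card
    simp only [Nat.cast_zero, zero_mul]
    positivity

theorem term_eq (n m : ℕ) (hn : 0 < n) (hm : m ≤ n) (b : ℝ) :
    (n.choose m : ℝ) * ((n : ℝ) ^ (n - m) * (m.factorial * b)) / (n : ℝ) ^ n =
      (∏ i ∈ Finset.range m, (1 - (i : ℝ) / n)) * b := by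
  have hn' : (n : ℝ) ≠ 0 := by positivity
  have h1 : ∏ i ∈ Finset.range m, (1 - (i : ℝ) / n) = (n.descFactorial m : ℝ) / (n : ℝ) ^ m := by
    rw [Nat.descFactorial_eq_prod_range, Nat.cast_prod]
    have h3 : (n : ℝ) ^ m = ∏ _i ∈ Finset.range m, (n : ℝ) := by simp
    rw [h3, ← Finset.prod_div_distrib]
    apply Finset.prod_congr rfl
    intro i hi
    have hi := Finset.mem_range.1 hi
    rw [Nat.cast_sub (by omega)]
    field_simp
  have h2 : (n : ℝ) ^ n = (n : ℝ) ^ (n - m) * (n : ℝ) ^ m := by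
    rw [← pow_add]; congr 1; omega
  rw [h1, h2, Nat.descFactorial_eq_factorial_mul_choose]
  push_cast
  field_simp

theorem sum_id (m : ℕ) : ∑ i ∈ Finset.range m, (i : ℝ) = m * (m - 1) / 2 := by
  induction m with
  | zero => simp
  | succ m ih => rw [Finset.sum_range_succ, ih]; push_cast; ring

theorem prod_upper (n m : ℕ) (hn : 0 < n) (hm : m ≤ n) :
    ∏ i ∈ Finset.range m, (1 - (i : ℝ) / n) ≤ Real.exp (1 / 2 - (m : ℝ) ^ 2 / (2 * n)) := by
  have hn' : (0 : ℝ) < n := by positivity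
  have hm' : (m : ℝ) ≤ n := by exact_mod_cast hm
  calc ∏ i ∈ Finset.range m, (1 - (i : ℝ) / n)
      ≤ ∏ i ∈ Finset.range m, Real.exp (-((i : ℝ) / n)) := by
        apply Finset.prod_le_prod
        · intro i hi
          have hi : (i : ℝ) < m := by exact_mod_cast Finset.mem_range.1 hi
          have : (i : ℝ) / n ≤ 1 := by rw [div_le_one hn']; linarith
          linarith
        · intro i _
          exact Real.one_sub_le_exp_neg _
    _ = Real.exp (-((m * (m - 1) / 2 : ℝ) / n)) := by
        rw [← Real.exp_sum, Finset.sum_neg_distrib, ← Finset.sum_div, sum_id]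
    _ ≤ _ := by
        apply Real.exp_le_exp.2
        have : 1 / 2 - (m : ℝ) ^ 2 / (2 * n) - (-((m * (m - 1) / 2 : ℝ) / n)) = (n - m) / (2 * n) := by
          field_simp; ring
        have h2 : 0 ≤ ((n : ℝ) - m) / (2 * n) := div_nonneg (by linarith) (by positivity)
        linarith

theorem exp_le_one_sub (x : ℝ) (h0 : 0 ≤ x) (h1 : x ≤ 1 / 2) :
    Real.exp (-(x + 2 * x ^ 2)) ≤ 1 - x := by
  rw [Real.exp_neg]
  have h2 := Real.add_one_le_exp (x + 2 * x ^ 2)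
  have h3 : 0 ≤ x ^ 2 * (1 - 2 * x) := by apply mul_nonneg (sq_nonneg x); linarith
  apply inv_le_of_inv_le₀ (by linarith)
  refine le_trans ?_ h2
  rw [inv_le_iff_one_le_mul₀ (by linarith)]
  nlinarith

theorem prod_lower (n j : ℕ) (hj : 2 ≤ j) (hn : j ^ 3 ≤ n) :
    Real.exp (-((j : ℝ) / 2 + 2)) ≤ ∏ i ∈ Finset.range (j ^ 2), (1 - (i : ℝ) / n) := by
  have hj' : (2 : ℝ) ≤ j := by exact_mod_cast hj
  have hn' : (j : ℝ) ^ 3 ≤ n := by exact_mod_cast hn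
  have hn0 : (0 : ℝ) < n := lt_of_lt_of_le (by positivity) hn'
  set y : ℝ := (j : ℝ) ^ 2 / n with hy
  have hy1 : y ≤ 1 / j := by
    rw [hy, div_le_div_iff₀ hn0 (by positivity)]; linarith [hn']
  have hy2 : y ≤ 1 / 2 := hy1.trans (one_div_le_one_div_of_le (by norm_num) hj')
  have hy0 : 0 ≤ y := by positivity
  calc Real.exp (-((j : ℝ) / 2 + 2))
      ≤ Real.exp (∑ i ∈ Finset.range (j ^ 2), (-((i : ℝ) / n + 2 * y ^ 2))) := by
        apply Real.exp_le_exp.2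
        rw [Finset.sum_neg_distrib, Finset.sum_add_distrib, ← Finset.sum_div, sum_id,
          Finset.sum_const, Finset.card_range, nsmul_eq_mul]
        push_cast
        have e1 : ((j : ℝ) ^ 2 * ((j : ℝ) ^ 2 - 1) / 2) / n ≤ j / 2 := by
          rw [div_le_iff₀ hn0]
          nlinarith [sq_nonneg (j : ℝ), mul_le_mul_of_nonneg_left hn' (by positivity : (0 : ℝ) ≤ j / 2)]
        have e2 : (j : ℝ) ^ 2 * (2 * y ^ 2) ≤ 2 := by
          have : (j : ℝ) * y ≤ 1 := by
            calc (j : ℝ) * y ≤ j * (1 / j) := by gcongr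
              _ = 1 := by field_simp
          have h0 : 0 ≤ (j : ℝ) * y := by positivity
          nlinarith
        linarith
    _ = ∏ i ∈ Finset.range (j ^ 2), Real.exp (-((i : ℝ) / n + 2 * y ^ 2)) := Real.exp_sum _ _
    _ ≤ _ := by
        apply Finset.prod_le_prod (fun _ _ => (Real.exp_pos _).le)
        intro i hi
        have hi : (i : ℝ) < (j : ℝ) ^ 2 := by exact_mod_cast Finset.mem_range.1 hi
        have h1 : (i : ℝ) / n ≤ y := by rw [hy]; gcongr
        have h0 : 0 ≤ (i : ℝ) / n := by positivity
        refine le_trans ?_ (exp_le_one_sub _ h0 (h1.trans hy2))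
        apply Real.exp_le_exp.2
        have : ((i : ℝ) / n) ^ 2 ≤ y ^ 2 := by gcongr
        linarith

theorem fact_bound (r : ℕ) : ((r + 1).factorial : ℝ) * Real.exp r ≤ ((r : ℝ) + 1) ^ (r + 2) := by
  induction r with
  | zero => simp
  | succ r ih =>
    have h1 : Real.exp 1 * ((r : ℝ) + 1) ^ (r + 2) ≤ ((r : ℝ) + 2) ^ (r + 2) := by
      have h := Real.one_sub_le_exp_neg (1 / ((r : ℝ) + 2))
      have e : 1 - 1 / ((r : ℝ) + 2) = ((r : ℝ) + 1) / (r + 2) := by field_simp; ring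
      rw [e] at h
      have h2 := pow_le_pow_left₀ (by positivity) h (r + 2)
      rw [← Real.exp_nat_mul] at h2
      have e2 : ((r + 2 : ℕ) : ℝ) * -(1 / ((r : ℝ) + 2)) = -1 := by push_cast; field_simp
      rw [e2, div_pow, div_le_iff₀ (by positivity)] at h2
      calc _ ≤ Real.exp 1 * (Real.exp (-1) * ((r : ℝ) + 2) ^ (r + 2)) := by gcongr
        _ = _ := by rw [← mul_assoc, ← Real.exp_add]; simp
    rw [Nat.factorial_succ]
    push_cast
    rw [Real.exp_add]
    calc ((r : ℝ) + 1 + 1) * ((r + 1).factorial : ℝ) * (Real.exp r * Real.exp 1)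
        = ((r : ℝ) + 2) * Real.exp 1 * (((r + 1).factorial : ℝ) * Real.exp r) := by ring
      _ ≤ ((r : ℝ) + 2) * Real.exp 1 * ((r : ℝ) + 1) ^ (r + 2) := by gcongr
      _ = ((r : ℝ) + 2) * (Real.exp 1 * ((r : ℝ) + 1) ^ (r + 2)) := by ring
      _ ≤ ((r : ℝ) + 2) * ((r : ℝ) + 2) ^ (r + 2) := by gcongr
      _ = _ := by ring

theorem bb_sq_lower (j : ℕ) (hj : 2 ≤ j) :
    Real.exp (2 * j - 3) ≤ (j : ℝ) ^ 3 * bb (j ^ 2) := by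
  obtain ⟨s, rfl⟩ : ∃ s, j = s + 2 := ⟨j - 2, by omega⟩
  set a : ℝ := (s : ℝ) + 1 with ha
  set c : ℝ := (s : ℝ) + 2 with hc
  have ha0 : 0 < a := by positivity
  have hc0 : 0 < c := by positivity
  have h0 := bb_lower (s + 1) ((s + 2) ^ 2 - 1)
  have hsq : (s + 2) ^ 2 - 1 + 1 = (s + 2) ^ 2 := by
    have : 0 < (s + 2) ^ 2 := by positivity
    omega
  rw [hsq] at h0
  have h1 : ((s + 2) * (s + 1)) ^ (s + 1) ≤ (s + 1).factorial * ((s + 2) ^ 2 - 1).choose (s + 1) := by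
    rw [← Nat.descFactorial_eq_factorial_mul_choose]
    refine le_trans ?_ (Nat.pow_sub_le_descFactorial _ _)
    apply Nat.pow_le_pow_left
    rw [hsq]
    apply Nat.le_sub_of_add_le
    ring_nf; omega
  have h1' : (c * a) ^ (s + 1) ≤ ((s + 1).factorial : ℝ) * (((s + 2) ^ 2 - 1).choose (s + 1) : ℝ) := by
    have : ((((s + 2) * (s + 1)) ^ (s + 1) : ℕ) : ℝ) ≤ (((s + 1).factorial * ((s + 2) ^ 2 - 1).choose (s + 1) : ℕ) : ℝ) := by
      exact_mod_cast h1
    push_cast at this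
    exact this
  have f1 := fact_bound s
  have f2 := fact_bound (s + 1)
  push_cast at f2
  rw [show (s : ℝ) + 1 + 1 = c by rw [hc]; ring] at f2
  rw [← ha] at f1 f2
  rw [div_le_iff₀ (by positivity)] at h0
  set K : ℝ := ((s + 1).factorial : ℝ)
  set L : ℝ := ((s + 1 + 1).factorial : ℝ)
  set X := bb ((s + 2) ^ 2)
  have hX : 0 < X := bb_pos _
  have hK : 0 < K := by positivity
  have hL : 0 < L := by positivity
  have h2 : (c * a) ^ (s + 1) ≤ K * (X * L) := h1'.trans (mul_le_mul_of_nonneg_left h0 hK.le)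
  have e1 : Real.exp (2 * ((s + 2 : ℕ) : ℝ) - 3) = Real.exp s * Real.exp a := by
    rw [← Real.exp_add, ha]; congr 1; push_cast; ring
  rw [e1]
  have e2 : ((s + 2 : ℕ) : ℝ) = c := by rw [hc]; push_cast; ring
  rw [e2]
  have hac : a ≤ c := by rw [ha, hc]; linarith
  clear_value K L X a c
  have h3 : (K * L) * (Real.exp s * Real.exp a) ≤ (K * L) * (c ^ 3 * X) := by
    calc (K * L) * (Real.exp s * Real.exp a) = (K * Real.exp s) * (L * Real.exp a) := by ring
      _ ≤ a ^ (s + 2) * c ^ (s + 1 + 2) := by gcongr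
      _ = a * c ^ 2 * (c * a) ^ (s + 1) := by rw [mul_pow]; ring
      _ ≤ c * c ^ 2 * (K * (X * L)) := by
        gcongr
      _ = _ := by ring
  exact le_of_mul_le_mul_left h3 (by positivity)

theorem opt (m n r : ℝ) (hm : 0 ≤ m) (hr : 0 < r) (hn : r ^ 3 = n) :
    2 * √m - m ^ 2 / (2 * n) ≤ 3 / 2 * r := by
  set u := √m
  have hu : 0 ≤ u := Real.sqrt_nonneg m
  have hm2 : m = u ^ 2 := (Real.sq_sqrt hm).symm
  set s := √r
  have hs : 0 < s := Real.sqrt_pos.2 hr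
  have hr2 : r = s ^ 2 := (Real.sq_sqrt hr.le).symm
  have hn0 : 0 < n := by rw [← hn]; positivity
  have key : 2 * u * (2 * n) - m ^ 2 ≤ 3 / 2 * r * (2 * n) := by
    rw [hm2, ← hn]
    have : 0 ≤ (u - r) ^ 2 * ((u + r) ^ 2 + 2 * r ^ 2) := by positivity
    nlinarith
  have : 2 * u - m ^ 2 / (2 * n) = (2 * u * (2 * n) - m ^ 2) / (2 * n) := by field_simp
  rw [this, div_le_iff₀ (by positivity)]
  exact key

/-- `E_n(B) = exp((3/2)·n^{1/3} + O(n^{1/6}))`. -/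
theorem expected_value_B :
    ∃ C > (0 : ℝ), ∃ N : ℕ, ∀ n : ℕ, N ≤ n →
      |Real.log ((∑ f : Fin n → Fin n, (B f : ℝ)) / (n : ℝ) ^ n) -
          (3 / 2) * (n : ℝ) ^ ((1 : ℝ) / 3)| ≤ C * (n : ℝ) ^ ((1 : ℝ) / 6) := by
  refine ⟨30, by norm_num, 8, ?_⟩
  intro n hn
  have hn1 : (8 : ℝ) ≤ n := by exact_mod_cast hn
  have hn0 : (0 : ℝ) < n := by linarith
  have hnn : 0 < n := by omega
  set r : ℝ := (n : ℝ) ^ ((1 : ℝ) / 3) with hr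
  set q : ℝ := (n : ℝ) ^ ((1 : ℝ) / 6) with hq
  have hr0 : 0 < r := Real.rpow_pos_of_pos hn0 _
  have hr3 : r ^ 3 = n := by
    rw [hr, ← Real.rpow_natCast, ← Real.rpow_mul hn0.le]; norm_num
  have hr2 : 2 ≤ r := by
    by_contra h
    push Not at h
    have : r ^ 3 < 2 ^ 3 := pow_lt_pow_left₀ h hr0.le (by norm_num)
    linarith
  have hq1 : 1 ≤ q := Real.one_le_rpow (by linarith) (by norm_num)
  have hlog : Real.log n ≤ 6 * q := by
    have := Real.log_le_rpow_div hn0.le (show (0 : ℝ) < 1 / 6 by norm_num)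
    rw [← hq] at this
    linarith
  set E : ℝ := (∑ f : Fin n → Fin n, (B f : ℝ)) / (n : ℝ) ^ n with hE
  -- upper bound
  have hU : E ≤ Real.exp (Real.log (n + 1) + 1 / 2 + 3 / 2 * r) := by
    have h1 : E ≤ ∑ m ∈ Finset.range (n + 1),
        (n.choose m : ℝ) * ((n : ℝ) ^ (n - m) * (m.factorial * bb m)) / (n : ℝ) ^ n := by
      rw [← Finset.sum_div]
      exact div_le_div_of_nonneg_right (sum_B_le n) (by positivity)
    have h2 : ∀ m ∈ Finset.range (n + 1),
        (n.choose m : ℝ) * ((n : ℝ) ^ (n - m) * (m.factorial * bb m)) / (n : ℝ) ^ n ≤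
          Real.exp (1 / 2 + 3 / 2 * r) := by
      intro m hm
      have hm : m ≤ n := by have := Finset.mem_range.1 hm; omega
      rw [term_eq n m hnn hm]
      calc _ ≤ Real.exp (1 / 2 - (m : ℝ) ^ 2 / (2 * n)) * Real.exp (2 * √m) :=
            mul_le_mul (prod_upper n m hnn hm) (bb_upper m) (bb_pos m).le (Real.exp_pos _).le
        _ ≤ _ := by
            rw [← Real.exp_add]
            apply Real.exp_le_exp.2
            have := opt m n r (by positivity) hr0 hr3
            linarith
    refine (h1.trans (Finset.sum_le_sum h2)).trans ?_
    rw [Finset.sum_const, Finset.card_range, nsmul_eq_mul, add_assoc,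
      Real.exp_add (Real.log _), Real.exp_log (by positivity)]
    push_cast
    exact le_refl _
  -- lower bound
  set j := ⌊r⌋₊ with hj
  have hjr : (j : ℝ) ≤ r := Nat.floor_le hr0.le
  have hjr' : r < j + 1 := Nat.lt_floor_add_one r
  have hj2 : 2 ≤ j := Nat.le_floor (by exact_mod_cast hr2)
  have hj2' : (2 : ℝ) ≤ j := by exact_mod_cast hj2
  have hj3 : j ^ 3 ≤ n := by
    have : (j : ℝ) ^ 3 ≤ n := by rw [← hr3]; gcongr
    exact_mod_cast this
  have hj2n : j ^ 2 ≤ n := (Nat.pow_le_pow_right (by omega) (by norm_num)).trans hj3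
  have hL : Real.exp (3 / 2 * j - 5 - Real.log n) ≤ E := by
    have h1 : (∏ i ∈ Finset.range (j ^ 2), (1 - (i : ℝ) / n)) * bb (j ^ 2) ≤ E := by
      rw [← term_eq n (j ^ 2) hnn hj2n]
      exact div_le_div_of_nonneg_right (le_sum_B n (j ^ 2)) (by positivity)
    refine le_trans ?_ h1
    have h2 : Real.exp (2 * j - 3) / n ≤ bb (j ^ 2) := by
      rw [div_le_iff₀ hn0]
      refine (bb_sq_lower j hj2).trans ?_
      rw [mul_comm]
      have : (j : ℝ) ^ 3 ≤ n := by exact_mod_cast hj3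
      exact mul_le_mul_of_nonneg_left this (bb_pos (j ^ 2)).le
    have h3 := prod_lower n j hj2 hj3
    calc _ = Real.exp (-((j : ℝ) / 2 + 2)) * (Real.exp (2 * j - 3) / n) := by
          rw [Real.exp_sub _ (Real.log n), Real.exp_log hn0, ← mul_div_assoc, ← Real.exp_add]
          congr 2; ring
      _ ≤ _ := mul_le_mul h3 h2 (by positivity) ((Real.exp_pos _).le.trans h3)
  have hE0 : 0 < E := lt_of_lt_of_le (Real.exp_pos _) hL
  have hU' := (Real.log_le_iff_le_exp hE0).2 hU
  have hL' := (Real.le_log_iff_exp_le hE0).2 hL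
  have hl1 : Real.log ((n : ℝ) + 1) ≤ Real.log n + 1 := by
    have h1 : Real.log ((n : ℝ) + 1) ≤ Real.log (2 * n) :=
      Real.log_le_log (by positivity) (by linarith)
    rw [Real.log_mul (by norm_num) hn0.ne'] at h1
    have := Real.log_two_lt_d9
    linarith
  rw [abs_le]
  constructor <;> linarith

end IterMap
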